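/- Let X be a nonempty compact metric space and f : X → X a continuous, surjective, strongly transitive map. Then for every x̃ ∈ X_f the set ⋃_{n ∈ ℕ} f̃^{-n}(Σ(x̃)) is dense in X_f. -/

import Mathlib

open Function Set

/-- A map `f : X → X` of a topological space is strongly transitive if for every
nonempty open set `U ⊆ X` there is `N ∈ ℕ` with `⋃_{n=0}^{N} f^n(U) = X`. -/
def StronglyTransitive {X : Type*} [TopologicalSpace X] (f : X → X) : Prop :=
  ∀ U : Set X, IsOpen U → U.Nonempty →
    ∃ N : ℕ, (⋃ n ∈ Finset.range (N + 1), f^[n] '' U) = Set.univ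

/-- The inverse limit (natural extension) of a map `f : X → X`, with the subspace
topology induced by the product topology on `X^ℤ`. -/
def InvLimit {X : Type*} (f : X → X) : Set (ℤ → X) :=
  {x | ∀ k : ℤ, f (x k) = x (k + 1)}

/-- The projection `π : X_f → X` onto the 0-th coordinate. -/
def InvLimit.proj {X : Type*} (f : X → X) (x : InvLimit f) : X := x.1 0

/-- The shift map `f̃ : X_f → X_f`, `(f̃ x̃)_k = x_{k+1}`. -/
def InvLimit.shift {X : Type*} (f : X → X) (x : InvLimit f) : InvLimit f :=
  ⟨fun k => x.1 (k + 1), fun k => x.2 (k + 1)⟩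

namespace InvLimit

variable {X : Type*} {f : X → X}

theorem apply_add_natCast (y : InvLimit f) (a : ℤ) (n : ℕ) :
    y.1 (a + n) = f^[n] (y.1 a) := by
  induction n with
  | zero => simp
  | succ n ih => rw [iterate_succ_apply', ← ih, y.2, Nat.cast_succ, add_assoc]

theorem shift_iterate_apply (y : InvLimit f) (n : ℕ) (k : ℤ) :
    ((shift f)^[n] y).1 k = y.1 (k + n) := by
  induction n generalizing y with
  | zero => simp
  | succ n ih =>
    rw [iterate_succ_apply, ih, Nat.cast_succ, ← add_assoc]
    rfl

/-- If `f` is surjective, every coordinate of the inverse limit can be prescribed. -/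
theorem exists_apply_eq (hf : Surjective f) (a : ℤ) (u : X) :
    ∃ y : InvLimit f, y.1 a = u := by
  obtain ⟨g, hg⟩ := hf.hasRightInverse
  refine ⟨⟨fun k => if a ≤ k then f^[(k - a).toNat] u else g^[(a - k).toNat] u,
    fun k => ?_⟩, by simp⟩
  dsimp only
  rcases lt_trichotomy (k + 1) a with h | h | h
  · rw [if_neg (by lia), if_neg (by lia),
      show (a - k).toNat = (a - (k + 1)).toNat + 1 by lia, iterate_succ_apply', hg]
  · rw [if_neg (by lia), if_pos h.ge, show (a - k).toNat = 1 by lia,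
      show (k + 1 - a).toNat = 0 by lia]
    exact hg u
  · rw [if_pos (by lia), if_pos h.le,
      show (k + 1 - a).toNat = (k - a).toNat + 1 by lia, iterate_succ_apply']

/-- The cylinders over open sets in the coordinates `-m`, `m ∈ ℕ`, form a basis. -/
theorem exists_cylinder_subset [TopologicalSpace X] (hf : Continuous f)
    {W : Set (InvLimit f)} (hW : IsOpen W) {z : InvLimit f} (hz : z ∈ W) :
    ∃ (m : ℕ) (U : Set X), IsOpen U ∧ z.1 (-m) ∈ U ∧ ∀ y : InvLimit f, y.1 (-m) ∈ U → y ∈ W := by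
  obtain ⟨V, hV, rfl⟩ := isOpen_induced_iff.mp hW
  obtain ⟨I, u, hu, hIV⟩ := isOpen_pi_iff.mp hV z.1 hz
  obtain ⟨m, hm⟩ : ∃ m : ℕ, ∀ i ∈ I, -(m : ℤ) ≤ i :=
    ⟨I.sup Int.natAbs, fun i hi => by
      have : i.natAbs ≤ I.sup Int.natAbs := Finset.le_sup hi
      lia⟩
  have key (y : InvLimit f) (i : ℤ) (hi : i ∈ I) : f^[(i + m).toNat] (y.1 (-m)) = y.1 i := by
    have hmi := hm i hi
    rw [← apply_add_natCast, show -(m : ℤ) + (i + m).toNat = i by lia]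
  refine ⟨m, ⋂ i ∈ I, f^[(i + m).toNat] ⁻¹' u i,
    isOpen_biInter_finset fun i hi => (hu i hi).1.preimage (hf.iterate _), ?_, ?_⟩
  · simp only [mem_iInter, mem_preimage]
    intro i hi
    rw [key z i hi]
    exact (hu i hi).2
  · intro y hy
    simp only [mem_iInter, mem_preimage] at hy
    exact hIV fun i hi => key y i hi ▸ hy i hi

end InvLimit

/-- If `f` is a continuous surjective strongly transitive map of a nonempty compact
metric space, then for every `x̃ ∈ X_f` the set `⋃_{n ∈ ℕ} f̃^{-n}(Σ(x̃))` is dense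
in `X_f`, where `Σ(x̃) = π^{-1}(π(x̃))` is the fiber of `x̃`. -/
theorem stmt8 {X : Type*} [MetricSpace X] [CompactSpace X] [Nonempty X]
    (f : X → X) (hf : Continuous f) (hsurj : Function.Surjective f)
    (hst : StronglyTransitive f) (x : InvLimit f) :
    Dense (⋃ n : ℕ, (InvLimit.shift f)^[n] ⁻¹'
      (InvLimit.proj f ⁻¹' {InvLimit.proj f x})) := by
  refine dense_iff_inter_open.mpr fun W hW ⟨z, hz⟩ => ?_
  obtain ⟨m, U, hU, hzU, hUW⟩ := InvLimit.exists_cylinder_subset hf hW hz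
  obtain ⟨N, hN⟩ := hst U hU ⟨_, hzU⟩
  obtain ⟨w, hw⟩ := hsurj.iterate m (InvLimit.proj f x)
  have hwN := hN.symm ▸ mem_univ w
  simp only [mem_iUnion] at hwN
  obtain ⟨k, -, u, huU, rfl⟩ := hwN
  obtain ⟨y, rfl⟩ := InvLimit.exists_apply_eq hsurj (-m) u
  refine ⟨y, hUW y huU, mem_iUnion.mpr ⟨k, ?_⟩⟩
  rw [mem_preimage, mem_preimage, mem_singleton_iff, InvLimit.proj,
    InvLimit.shift_iterate_apply, ← hw, ← InvLimit.apply_add_natCast,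
    ← InvLimit.apply_add_natCast, show -(m : ℤ) + k + m = 0 + k by ring]
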